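/- Assume relations (R1), (R2) and (R3) hold in R. Then: (i) [e_{i,j}, e_{p,r}]_c = 0 whenever 1 ≤ i < p < r < j ≤ n+1; (ii) [e_{i,j}, e_{i,r}]_c = 0 whenever 1 ≤ i < j < r ≤ n+1; (iii) [e_{i,j}, e_{p,j}]_c = 0 whenever 1 ≤ i < p < j ≤ n+1. (Lemma 'lema2.2.201', equations (2.2.41), (2.2.42), (2.2.43).) -/

import Mathlib

/-- `B(i,j;p,r) = ∏_{i≤ℓ≤j−1} ∏_{p≤h≤r−1} q_{ℓ,h}`. -/
def Bq {k : Type*} [Field k] (qm : ℕ → ℕ → k) (i j p r : ℕ) : k :=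
  ∏ l ∈ Finset.Ico i j, ∏ h ∈ Finset.Ico p r, qm l h

/-- The iterated braided commutators `e_{i,j}`: `e_{i,i+1} = x_i` and
`e_{i,j} = e_{i,j−1}·e_{j−1,j} − B(i,j−1;j−1,j)·e_{j−1,j}·e_{i,j−1}` for `j − i ≥ 2`. -/
def ee {k R : Type*} [Field k] [Ring R] [Algebra k R]
    (qm : ℕ → ℕ → k) (x : ℕ → R) : ℕ → ℕ → R
  | i, j =>
    if _ : j ≤ i + 1 then x i
    else
      ee qm x i (j - 1) * ee qm x (j - 1) j
        - Bq qm i (j - 1) (j - 1) j • (ee qm x (j - 1) j * ee qm x i (j - 1))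
  termination_by i j => j - i
  decreasing_by all_goals omega

section BraidedCommutators

variable {k R : Type*} [Field k] [Ring R] [Algebra k R] {qm : ℕ → ℕ → k} {x : ℕ → R}

theorem Bq_mul_left (qm : ℕ → ℕ → k) {i m j : ℕ} (p r : ℕ) (him : i ≤ m) (hmj : m ≤ j) :
    Bq qm i m p r * Bq qm m j p r = Bq qm i j p r :=
  Finset.prod_Ico_consecutive _ him hmj

theorem Bq_mul_right (qm : ℕ → ℕ → k) (i j : ℕ) {p m r : ℕ} (hpm : p ≤ m) (hmr : m ≤ r) :
    Bq qm i j p m * Bq qm i j m r = Bq qm i j p r := by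
  simp only [Bq, ← Finset.prod_mul_distrib, Finset.prod_Ico_consecutive _ hpm hmr]

theorem Bq_succ_succ (qm : ℕ → ℕ → k) (i p : ℕ) : Bq qm i (i + 1) p (p + 1) = qm i p := by
  simp [Bq]

theorem ee_succ_self (qm : ℕ → ℕ → k) (x : ℕ → R) (i : ℕ) : ee qm x i (i + 1) = x i := by
  rw [ee]; simp

/-- `e_{i,j}` and `e_{p,r}` braided-commute: `[e_{i,j}, e_{p,r}]_c = 0`. -/
def BraidComm (qm : ℕ → ℕ → k) (x : ℕ → R) (i j p r : ℕ) : Prop :=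
  ee qm x i j * ee qm x p r = Bq qm i j p r • (ee qm x p r * ee qm x i j)

/-- `e_{i,j}` is the braided commutator of `e_{i,m}` and `e_{m,j}`. -/
def SplitsAt (qm : ℕ → ℕ → k) (x : ℕ → R) (i m j : ℕ) : Prop :=
  ee qm x i j = ee qm x i m * ee qm x m j - Bq qm i m m j • (ee qm x m j * ee qm x i m)

theorem splitsAt_last {i j : ℕ} (h : i < j) : SplitsAt qm x i j (j + 1) := by
  rw [SplitsAt, ee, dif_neg (by omega)]
  rfl

theorem mul_braided_of_mul {a b c : k} {u v w : R} (hv : u * v = a • (v * u))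
    (hw : u * w = b • (w * u)) :
    u * (v * w - c • (w * v)) = (a * b) • ((v * w - c • (w * v)) * u) := by
  linear_combination (norm := skip) hv * w + a • (v * hw) - (c • (hw * v) + (c * b) • (w * hv))
  simp only [mul_sub, sub_mul, smul_mul_assoc, mul_smul_comm, mul_assoc]
  module

theorem braided_mul_of_mul {a b c : k} {u v w : R} (hv : v * u = a • (u * v))
    (hw : w * u = b • (u * w)) :
    (v * w - c • (w * v)) * u = (a * b) • (u * (v * w - c • (w * v))) := by
  linear_combination (norm := skip) v * hw + b • (hv * w) - (c • (w * hv) + (c * a) • (hw * v))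
  simp only [mul_sub, sub_mul, smul_mul_assoc, mul_smul_comm, mul_assoc]
  module

theorem BraidComm.right {i j p m r : ℕ} (hs : SplitsAt qm x p m r) (hpm : p ≤ m) (hmr : m ≤ r)
    (h₁ : BraidComm qm x i j p m) (h₂ : BraidComm qm x i j m r) : BraidComm qm x i j p r := by
  rw [BraidComm, hs, ← Bq_mul_right qm i j hpm hmr]
  exact mul_braided_of_mul h₁ h₂

theorem BraidComm.left {i m j p r : ℕ} (hs : SplitsAt qm x i m j) (him : i ≤ m) (hmj : m ≤ j)
    (h₁ : BraidComm qm x i m p r) (h₂ : BraidComm qm x m j p r) : BraidComm qm x i j p r := by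
  rw [BraidComm, hs, ← Bq_mul_left qm p r him hmj]
  exact braided_mul_of_mul h₁ h₂

theorem BraidComm.of_right_generators {i j p r : ℕ} (hpr : p < r)
    (h : ∀ m, p ≤ m → m < r → BraidComm qm x i j m (m + 1)) : BraidComm qm x i j p r := by
  induction r, hpr using Nat.le_induction with
  | base => exact h p le_rfl (by omega)
  | succ r hr ih =>
    exact .right (splitsAt_last hr) (by omega) (by omega)
      (ih fun m h₁ h₂ => h m h₁ (by omega)) (h r (by omega) (by omega))

theorem BraidComm.of_left_generators {i j p r : ℕ} (hij : i < j)
    (h : ∀ m, i ≤ m → m < j → BraidComm qm x m (m + 1) p r) : BraidComm qm x i j p r := by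
  induction j, hij using Nat.le_induction with
  | base => exact h i le_rfl (by omega)
  | succ j hj ih =>
    exact .left (splitsAt_last hj) (by omega) (by omega)
      (ih fun m h₁ h₂ => h m h₁ (by omega)) (h j (by omega) (by omega))

theorem BraidComm.symm {i j p r : ℕ} (h : BraidComm qm x i j p r)
    (hB : Bq qm p r i j * Bq qm i j p r = 1) : BraidComm qm x p r i j := by
  rw [BraidComm, show ee qm x i j * ee qm x p r = _ from h, smul_smul, hB, one_smul]

/-- If generators at distance at least two braided-commute, then so do `e_{i,m}` and the
generators beyond `m`, and `e_{i,j}` is the braided commutator of `e_{i,m}` and `e_{m,j}`. -/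
theorem splitsAt_of_far {n : ℕ}
    (hfar : ∀ l h, 1 ≤ l → l + 2 ≤ h → h ≤ n → BraidComm qm x l (l + 1) h (h + 1))
    {i m j : ℕ} (hi : 1 ≤ i) (him : i < m) (hmj : m < j) (hj : j ≤ n + 1) :
    SplitsAt qm x i m j := by
  induction j, hmj using Nat.le_induction with
  | base => exact splitsAt_last him
  | succ j hmj ih =>
    have hc : BraidComm qm x i m j (j + 1) :=
      .of_left_generators him fun l _ _ => hfar l j (by omega) (by omega) (by omega)
    have ih := ih (by omega)
    have hl : SplitsAt qm x i j (j + 1) := splitsAt_last (by omega)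
    have hr : SplitsAt qm x m j (j + 1) := splitsAt_last (by omega)
    unfold SplitsAt at *
    rw [hl, hr, ih, ← Bq_mul_left qm j (j + 1) him.le (show m ≤ j by omega),
      ← Bq_mul_right qm i m (show m ≤ j by omega) (show j ≤ j + 1 by omega)]
    unfold BraidComm at hc
    generalize ee qm x i m = u at *
    generalize ee qm x m j = v at *
    generalize ee qm x j (j + 1) = w at *
    generalize Bq qm i m j (j + 1) = a at *
    generalize Bq qm m j j (j + 1) = b at *
    generalize Bq qm i m m j = c at *
    linear_combination (norm := skip) -c • (v * hc) + b • (hc * v)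
    simp only [mul_sub, sub_mul, smul_mul_assoc, mul_smul_comm, mul_assoc]
    module

/-- The rank three identity: the middle generator `b` braided-commutes with the iterated
braided commutator `w` of `a`, `b`, `c`. -/
theorem rank_three_middle {q s t y : k} (hq : q + 1 ≠ 0) (ht : t ≠ 0) {a b c u v w : R}
    (hu : u = a * b - s • (b * a)) (hv : v = b * c - t • (c * b))
    (hwu : w = u * c - (y * t) • (c * u)) (hwv : w = a * v - (s * y) • (v * a))
    (hub : u * b = (s * q) • (b * u)) (hbv : b * v = (q * t) • (v * b)) :
    w * b = (s * t⁻¹) • (b * w) := by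
  have h₁ : u * v = (s * q) • (b * w) - t • (w * b) + (s * y * t * q) • (v * u) := by
    rw [hwu]
    linear_combination (norm := skip) u * hv + hub * c - (s * y * t * q) • (hv * u)
      - (t * y * t) • (c * hub)
    simp only [mul_sub, sub_mul, smul_mul_assoc, mul_smul_comm, mul_assoc]
    module
  have h₂ : u * v = (q * t) • (w * b) - s • (b * w) + (s * y * t * q) • (v * u) := by
    rw [hwv]
    linear_combination (norm := skip) hu * v + a * hbv - (s * y * t * q) • (v * hu)
      - (s * s * y) • (hbv * a)
    simp only [mul_sub, sub_mul, smul_mul_assoc, mul_smul_comm, mul_assoc]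
    module
  have h₃ : ((q + 1) * t) • (w * b) = ((q + 1) * s) • (b * w) := by
    linear_combination (norm := module) h₁ - h₂
  have hqt : (q + 1) * t ≠ 0 := mul_ne_zero hq ht
  rw [← inv_smul_smul₀ hqt (w * b), h₃, smul_smul]
  congr 1
  field_simp

end BraidedCommutators

/-- Lemma `lema2.2.201`, equations (2.2.41), (2.2.42), (2.2.43). -/
theorem lema2_2_201 {k R : Type*} [Field k] [Ring R] [Algebra k R]
    (n N : ℕ) (hn : 1 ≤ n) (hN : 2 < N) (q : k) (hq : IsPrimitiveRoot q N)
    (qm : ℕ → ℕ → k)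
    (hqne : ∀ i j, 1 ≤ i → i ≤ n → 1 ≤ j → j ≤ n → qm i j ≠ 0)
    (hdiag : ∀ i, 1 ≤ i → i ≤ n → qm i i = q)
    (hadj : ∀ i j, 1 ≤ i → i ≤ n → 1 ≤ j → j ≤ n → (i = j + 1 ∨ j = i + 1) →
      qm i j * qm j i = q⁻¹)
    (hfar : ∀ i j, 1 ≤ i → i ≤ n → 1 ≤ j → j ≤ n → (i + 2 ≤ j ∨ j + 2 ≤ i) →
      qm i j * qm j i = 1)
    (x : ℕ → R)
    (R1 : ∀ i p, 1 ≤ i → i < p → p ≤ n → i + 2 ≤ p →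
      x i * x p = qm i p • (x p * x i))
    (R2 : ∀ i, 1 ≤ i → i < n →
      ee qm x i (i+1) * ee qm x i (i+2)
        = Bq qm i (i+1) i (i+2) • (ee qm x i (i+2) * ee qm x i (i+1)))
    (R3 : ∀ i, 1 ≤ i → i < n →
      ee qm x i (i+2) * ee qm x (i+1) (i+2)
        = Bq qm i (i+2) (i+1) (i+2) • (ee qm x (i+1) (i+2) * ee qm x i (i+2)))
    : (∀ i p r j, 1 ≤ i → i < p → p < r → r < j → j ≤ n + 1 →
        ee qm x i j * ee qm x p r = Bq qm i j p r • (ee qm x p r * ee qm x i j)) ∧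
      (∀ i j r, 1 ≤ i → i < j → j < r → r ≤ n + 1 →
        ee qm x i j * ee qm x i r = Bq qm i j i r • (ee qm x i r * ee qm x i j)) ∧
      (∀ i p j, 1 ≤ i → i < p → p < j → j ≤ n + 1 →
        ee qm x i j * ee qm x p j = Bq qm i j p j • (ee qm x p j * ee qm x i j)) := by
  have hq0 : q ≠ 0 := hdiag 1 le_rfl hn ▸ hqne 1 1 le_rfl hn le_rfl hn
  have hq1 : q + 1 ≠ 0 := by
    intro h
    have h2 : q ^ 2 = 1 := by rw [eq_neg_of_add_eq_zero_left h]; ring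
    exact absurd (Nat.le_of_dvd two_pos (hq.dvd_of_pow_eq_one 2 h2)) (by omega)
  have far : ∀ l h, 1 ≤ l → l + 2 ≤ h → h ≤ n → BraidComm qm x l (l + 1) h (h + 1) := by
    intro l h h₁ h₂ h₃
    rw [BraidComm, ee_succ_self, ee_succ_self, Bq_succ_succ]
    exact R1 l h h₁ (by omega) h₃ h₂
  have far' : ∀ l h, 1 ≤ l → l + 2 ≤ h → h ≤ n → BraidComm qm x h (h + 1) l (l + 1) := by
    intro l h h₁ h₂ h₃
    refine (far l h h₁ h₂ h₃).symm ?_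
    rw [Bq_succ_succ, Bq_succ_succ]
    exact hfar h l (by omega) h₃ h₁ (by omega) (.inr h₂)
  have split {i m j : ℕ} (hi : 1 ≤ i) (him : i < m) (hmj : m < j) (hj : j ≤ n + 1) :
      SplitsAt qm x i m j := splitsAt_of_far far hi him hmj hj
  have mid : ∀ i, 1 ≤ i → i + 3 ≤ n + 1 → BraidComm qm x i (i + 3) (i + 1) (i + 2) := by
    intro i hi hin
    have hub := R3 i hi (by omega)
    have hbv := R2 (i + 1) (by omega) (by omega)
    have hu : SplitsAt qm x i (i + 1) (i + 2) := split hi (by omega) (by omega) (by omega)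
    have hv : SplitsAt qm x (i + 1) (i + 2) (i + 3) :=
      split (by omega) (by omega) (by omega) (by omega)
    have hwu : SplitsAt qm x i (i + 2) (i + 3) := split hi (by omega) (by omega) (by omega)
    have hwv : SplitsAt qm x i (i + 1) (i + 3) := split hi (by omega) (by omega) (by omega)
    have ht : qm (i + 1) (i + 2) ≠ 0 := hqne _ _ (by omega) (by omega) (by omega) (by omega)
    have hd := hdiag (i + 1) (by omega) (by omega)
    have ha := hadj (i + 2) (i + 1) (by omega) (by omega) (by omega) (by omega) (.inl rfl)
    have ha' : qm (i + 2) (i + 1) = q⁻¹ * (qm (i + 1) (i + 2))⁻¹ := by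
      rw [← ha, mul_inv_cancel_right₀ ht]
    unfold SplitsAt at hu hv hwu hwv
    have hB : Bq qm i (i + 3) (i + 1) (i + 2) = qm i (i + 1) * (qm (i + 1) (i + 2))⁻¹ := by
      simp [Bq, Finset.prod_Ico_succ_top, hd, ha']
      field_simp
    rw [BraidComm, hB]
    have e₁ : Bq qm i (i + 1) (i + 1) (i + 2) = qm i (i + 1) := Bq_succ_succ qm i (i + 1)
    have e₂ : Bq qm (i + 1) (i + 2) (i + 2) (i + 3) = qm (i + 1) (i + 2) :=
      Bq_succ_succ qm (i + 1) (i + 2)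
    have e₃ : Bq qm i (i + 2) (i + 2) (i + 3) = qm i (i + 2) * qm (i + 1) (i + 2) := by
      simp [Bq, Finset.prod_Ico_succ_top]
    have e₄ : Bq qm i (i + 1) (i + 1) (i + 3) = qm i (i + 1) * qm i (i + 2) := by
      simp [Bq, Finset.prod_Ico_succ_top]
    have e₅ : Bq qm i (i + 2) (i + 1) (i + 2) = qm i (i + 1) * q := by
      simp [Bq, Finset.prod_Ico_succ_top, hd]
    have e₆ : Bq qm (i + 1) (i + 2) (i + 1) (i + 3) = q * qm (i + 1) (i + 2) := by
      simp [Bq, Finset.prod_Ico_succ_top, hd]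
    rw [e₁] at hu
    rw [e₂] at hv
    rw [e₃] at hwu
    rw [e₄] at hwv
    rw [e₅] at hub
    exact rank_three_middle hq1 ht hu hv hwu hwv hub (e₆ ▸ hbv)
  have mid' : ∀ i, 1 ≤ i → i + 3 ≤ n + 1 → BraidComm qm x (i + 1) (i + 2) i (i + 3) := by
    intro i hi hin
    refine (mid i hi hin).symm ?_
    have hd := hdiag (i + 1) (by omega) (by omega)
    have h₁ := hadj i (i + 1) (by omega) (by omega) (by omega) (by omega) (.inr rfl)
    have h₂ := hadj (i + 2) (i + 1) (by omega) (by omega) (by omega) (by omega) (.inl rfl)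
    have hB : Bq qm (i + 1) (i + 2) i (i + 3) * Bq qm i (i + 3) (i + 1) (i + 2)
        = qm (i + 1) i * q * qm (i + 1) (i + 2) * (qm i (i + 1) * q * qm (i + 2) (i + 1)) := by
      simp [Bq, Finset.prod_Ico_succ_top, hd]
    rw [hB]
    linear_combination q ^ 2 * qm (i + 2) (i + 1) * qm (i + 1) (i + 2) * h₁ + q ^ 2 * q⁻¹ * h₂
      + (q * q⁻¹ + 1) * mul_inv_cancel₀ hq0
  have interior : ∀ i p j, 1 ≤ i → i < p → p + 1 < j → j ≤ n + 1 →
      BraidComm qm x i j p (p + 1) := by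
    intro i p j hi hip hpj hj
    obtain ⟨a, rfl⟩ : ∃ a, p = a + 1 := ⟨p - 1, by omega⟩
    have h : BraidComm qm x a j (a + 1) (a + 2) := by
      rcases (show a + 3 = j ∨ a + 3 < j by omega) with rfl | h
      · exact mid a (by omega) hj
      · exact .left (split (by omega) (by omega) h hj) (by omega) h.le
          (mid a (by omega) (by omega))
          (.of_left_generators h fun l _ _ => far' _ _ (by omega) (by omega) (by omega))
    rcases (show i = a ∨ i < a by omega) with rfl | h'
    · exact h
    · exact .left (split hi h' (by omega) hj) h'.le (by omega)
        (.of_left_generators h' fun l _ _ => far _ _ (by omega) (by omega) (by omega)) h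
  have interior' : ∀ i p j, 1 ≤ i → i < p → p + 1 < j → j ≤ n + 1 →
      BraidComm qm x p (p + 1) i j := by
    intro i p j hi hip hpj hj
    obtain ⟨a, rfl⟩ : ∃ a, p = a + 1 := ⟨p - 1, by omega⟩
    have h : BraidComm qm x (a + 1) (a + 2) a j := by
      rcases (show a + 3 = j ∨ a + 3 < j by omega) with rfl | h
      · exact mid' a (by omega) hj
      · exact .right (split (by omega) (by omega) h hj) (by omega) h.le
          (mid' a (by omega) (by omega))
          (.of_right_generators h fun l _ _ => far _ _ (by omega) (by omega) (by omega))
    rcases (show i = a ∨ i < a by omega) with rfl | h'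
    · exact h
    · exact .right (split hi h' (by omega) hj) h'.le (by omega)
        (.of_right_generators h' fun l _ _ => far' _ _ (by omega) (by omega) (by omega)) h
  have first : ∀ i r, 1 ≤ i → i + 1 < r → r ≤ n + 1 → BraidComm qm x i (i + 1) i r := by
    intro i r hi hir hr
    rcases (show i + 2 = r ∨ i + 2 < r by omega) with rfl | h
    · exact R2 i hi (by omega)
    · exact .right (split hi (by omega) h hr) (by omega) h.le (R2 i hi (by omega))
        (.of_right_generators h fun l _ _ => far _ _ hi (by omega) (by omega))
  have last : ∀ i p, 1 ≤ i → i < p → p ≤ n → BraidComm qm x i (p + 1) p (p + 1) := by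
    intro i p hi hip hp
    obtain ⟨a, rfl⟩ : ∃ a, p = a + 1 := ⟨p - 1, by omega⟩
    rcases (show i = a ∨ i < a by omega) with rfl | h
    · exact R3 i hi (by omega)
    · exact .left (split hi h (by omega) (by omega)) h.le (by omega)
        (.of_left_generators h fun l _ _ => far _ _ (by omega) (by omega) hp)
        (R3 a (by omega) (by omega))
  refine ⟨fun i p r j hi hip hpr hrj hj => ?_, fun i j r hi hij hjr hr => ?_,
    fun i p j hi hip hpj hj => ?_⟩
  · exact BraidComm.of_right_generators hpr fun m _ _ =>
      interior i m j hi (by omega) (by omega) hj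
  · refine BraidComm.of_left_generators hij fun m hm _ => ?_
    rcases hm.eq_or_lt with rfl | hm
    · exact first i r hi (by omega) hr
    · exact interior' i m r hi hm (by omega) hr
  · refine BraidComm.of_right_generators hpj fun m hm hmj => ?_
    rcases (show m + 1 = j ∨ m + 1 < j by omega) with rfl | h
    · exact last i m hi (by omega) (by omega)
    · exact interior i m j hi (by omega) h hj
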